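/- The K-algebras A(m,n) and B(m,n) are isomorphic. Explicitly, the map sending (entrywise) e^{p,k,l} of A(m,n) to e^{p,k,l} if |k−l| ≤ 1, to e^{p,k,k−1} e^{p,k−1,k−2} ⋯ e^{p,l+1,l} if k−l > 1, and to e^{p,k,k+1} e^{p,k+1,k+2} ⋯ e^{p,l−1,l} if k−l < −1, is a well-defined K-algebra isomorphism A(m,n) → B(m,n) whose inverse sends e^{p,k,l} of B(m,n) to e^{p,k,l} of A(m,n). -/

import Mathlib

open scoped BigOperators

/-- The block-diagonal matrix `⊕^t A` (with `t` copies of `A ∈ M_{a×b}` on the diagonal and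
zeros elsewhere), written as a matrix with `e = t*a` rows and `f = t*b` columns: the entry at
(0-indexed) position `(i,j)` is `A (i % a) (j % b)` if `i / a = j / b`, and `0` otherwise. -/
def blockOplus {R : Type} [Semiring R] {a b : ℕ} (ha : 0 < a) (hb : 0 < b) (e f : ℕ)
    (A : Matrix (Fin a) (Fin b) R) : Matrix (Fin e) (Fin f) R :=
  Matrix.of fun i j =>
    if (i : ℕ) / a = (j : ℕ) / b then
      A ⟨(i : ℕ) % a, Nat.mod_lt _ ha⟩ ⟨(j : ℕ) % b, Nat.mod_lt _ hb⟩
    else 0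

/-- Generators of the algebra `A(m,n)`: `⟨p, k, l, i, j⟩` stands for the generator
`e^{p+1,k,l}_{ij}` (everything 0-indexed, so the stored `p : ℕ` represents the paper's
`p ≥ 1` shifted by one; `k, l ∈ Fin n`; `i, j ∈ Fin (m^(p+1))`). -/
abbrev AGen (m n : ℕ) := Σ p : ℕ, Fin n × Fin n × Fin (m ^ (p + 1)) × Fin (m ^ (p + 1))

/-- The matrix `e^{p+1,k,l}` of generators, as a matrix over the free algebra. -/
noncomputable def EmF (K : Type) [Field K] (m n : ℕ) (p : ℕ) (k l : Fin n) :
    Matrix (Fin (m ^ (p + 1))) (Fin (m ^ (p + 1))) (FreeAlgebra K (AGen m n)) :=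
  Matrix.of fun i j => FreeAlgebra.ι K (⟨p, k, l, i, j⟩ : AGen m n)

/-- The defining relations of `A(m,n)` (entrywise):
(i) `e^{p,k,l} e^{p,k',l'} = δ_{l,k'} e^{p,k,l'}` and
(ii) `∑_k e^{p,k,k} = ⊕^m e^{p−1,1,1}` (with `e^{0,1,1} = (1)`). -/
inductive ARel (K : Type) [Field K] (m n : ℕ) (hm : 0 < m) (hn : 0 < n) :
    FreeAlgebra K (AGen m n) → FreeAlgebra K (AGen m n) → Prop
  | mul (p : ℕ) (k l k' l' : Fin n) (i j : Fin (m ^ (p + 1))) :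
      ARel K m n hm hn ((EmF K m n p k l * EmF K m n p k' l') i j)
        (if l = k' then EmF K m n p k l' i j else 0)
  | sum0 (i j : Fin (m ^ (0 + 1))) :
      ARel K m n hm hn (∑ kk : Fin n, EmF K m n 0 kk kk i j) (if i = j then 1 else 0)
  | sumS (p : ℕ) (i j : Fin (m ^ (p + 1 + 1))) :
      ARel K m n hm hn (∑ kk : Fin n, EmF K m n (p + 1) kk kk i j)
        (if (i : ℕ) / m ^ (p + 1) = (j : ℕ) / m ^ (p + 1) then
          EmF K m n p ⟨0, hn⟩ ⟨0, hn⟩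
            ⟨(i : ℕ) % m ^ (p + 1), Nat.mod_lt _ (pow_pos hm _)⟩
            ⟨(j : ℕ) % m ^ (p + 1), Nat.mod_lt _ (pow_pos hm _)⟩
        else 0)

/-- The algebra `A(m,n)`. -/
abbrev AAlg (K : Type) [Field K] (m n : ℕ) (hm : 0 < m) (hn : 0 < n) :=
  RingQuot (ARel K m n hm hn)

/-- The image of a generator in `A(m,n)`. -/
noncomputable def mkA (K : Type) [Field K] {m n : ℕ} (hm : 0 < m) (hn : 0 < n)
    (g : AGen m n) : AAlg K m n hm hn :=
  RingQuot.mkAlgHom K (ARel K m n hm hn) (FreeAlgebra.ι K g)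

/-- The matrix `e^{p+1,k,l}` over `A(m,n)`. -/
noncomputable def eA (K : Type) [Field K] {m n : ℕ} (hm : 0 < m) (hn : 0 < n)
    (p : ℕ) (k l : Fin n) :
    Matrix (Fin (m ^ (p + 1))) (Fin (m ^ (p + 1))) (AAlg K m n hm hn) :=
  (EmF K m n p k l).map (RingQuot.mkAlgHom K (ARel K m n hm hn))

/-- Generators of the algebra `B(m,n)`: the generators `e^{p,k,l}_{ij}` of `A(m,n)` with
`|k − l| ≤ 1`. -/
abbrev BGen (m n : ℕ) :=
  {g : AGen m n // (g.2.1 : ℕ) ≤ (g.2.2.1 : ℕ) + 1 ∧ (g.2.2.1 : ℕ) ≤ (g.2.1 : ℕ) + 1}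

/-- The matrix `e^{p+1,k,l}` (with `|k − l| ≤ 1`) of generators of `B(m,n)` over the free
algebra. -/
noncomputable def EmB (K : Type) [Field K] (m n : ℕ) (p : ℕ) (k l : Fin n)
    (h : (k : ℕ) ≤ (l : ℕ) + 1 ∧ (l : ℕ) ≤ (k : ℕ) + 1) :
    Matrix (Fin (m ^ (p + 1))) (Fin (m ^ (p + 1))) (FreeAlgebra K (BGen m n)) :=
  Matrix.of fun i j => FreeAlgebra.ι K (⟨⟨p, k, l, i, j⟩, h⟩ : BGen m n)

/-- The defining relations of `B(m,n)` (entrywise):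
(i) `e^{p,k,l} e^{p,k',l'} = 0` if `l ≠ k'`;
(ii) `e^{p,k,l} e^{p,k',l'} = e^{p,k,l'}` if `l = k'` and `|k − l'| ≤ 1`;
(iii) `∑_k e^{p,k,k} = ⊕^m e^{p−1,1,1}` (with `e^{0,1,1} = (1)`). -/
inductive BRel (K : Type) [Field K] (m n : ℕ) (hm : 0 < m) (hn : 0 < n) :
    FreeAlgebra K (BGen m n) → FreeAlgebra K (BGen m n) → Prop
  | mul0 (p : ℕ) (k l k' l' : Fin n) (hkl : (k : ℕ) ≤ (l : ℕ) + 1 ∧ (l : ℕ) ≤ (k : ℕ) + 1)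
      (hk'l' : (k' : ℕ) ≤ (l' : ℕ) + 1 ∧ (l' : ℕ) ≤ (k' : ℕ) + 1) (hne : l ≠ k')
      (i j : Fin (m ^ (p + 1))) :
      BRel K m n hm hn ((EmB K m n p k l hkl * EmB K m n p k' l' hk'l') i j) 0
  | mul1 (p : ℕ) (k l l' : Fin n) (hkl : (k : ℕ) ≤ (l : ℕ) + 1 ∧ (l : ℕ) ≤ (k : ℕ) + 1)
      (hll' : (l : ℕ) ≤ (l' : ℕ) + 1 ∧ (l' : ℕ) ≤ (l : ℕ) + 1)
      (hkl' : (k : ℕ) ≤ (l' : ℕ) + 1 ∧ (l' : ℕ) ≤ (k : ℕ) + 1)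
      (i j : Fin (m ^ (p + 1))) :
      BRel K m n hm hn ((EmB K m n p k l hkl * EmB K m n p l l' hll') i j)
        (EmB K m n p k l' hkl' i j)
  | sum0 (i j : Fin (m ^ (0 + 1))) :
      BRel K m n hm hn
        (∑ kk : Fin n, EmB K m n 0 kk kk ⟨Nat.le_succ _, Nat.le_succ _⟩ i j)
        (if i = j then 1 else 0)
  | sumS (p : ℕ) (i j : Fin (m ^ (p + 1 + 1))) :
      BRel K m n hm hn
        (∑ kk : Fin n, EmB K m n (p + 1) kk kk ⟨Nat.le_succ _, Nat.le_succ _⟩ i j)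
        (if (i : ℕ) / m ^ (p + 1) = (j : ℕ) / m ^ (p + 1) then
          EmB K m n p ⟨0, hn⟩ ⟨0, hn⟩ ⟨Nat.le_succ _, Nat.le_succ _⟩
            ⟨(i : ℕ) % m ^ (p + 1), Nat.mod_lt _ (pow_pos hm _)⟩
            ⟨(j : ℕ) % m ^ (p + 1), Nat.mod_lt _ (pow_pos hm _)⟩
        else 0)

/-- The algebra `B(m,n)`. -/
abbrev BAlg (K : Type) [Field K] (m n : ℕ) (hm : 0 < m) (hn : 0 < n) :=
  RingQuot (BRel K m n hm hn)

/-- The image of a generator in `B(m,n)`. -/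
noncomputable def mkB (K : Type) [Field K] {m n : ℕ} (hm : 0 < m) (hn : 0 < n)
    (g : BGen m n) : BAlg K m n hm hn :=
  RingQuot.mkAlgHom K (BRel K m n hm hn) (FreeAlgebra.ι K g)

/-- The matrix `e^{p+1,k,l}` over `B(m,n)`. -/
noncomputable def eB (K : Type) [Field K] {m n : ℕ} (hm : 0 < m) (hn : 0 < n)
    (p : ℕ) (k l : Fin n) (h : (k : ℕ) ≤ (l : ℕ) + 1 ∧ (l : ℕ) ≤ (k : ℕ) + 1) :
    Matrix (Fin (m ^ (p + 1))) (Fin (m ^ (p + 1))) (BAlg K m n hm hn) :=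
  (EmB K m n p k l h).map (RingQuot.mkAlgHom K (BRel K m n hm hn))

/-- The image of the matrix `e^{p,k,l}` of `A(m,n)` in `B(m,n)`:
`e^{p,k,l}` itself if `|k − l| ≤ 1`, the product `e^{p,k,k−1} e^{p,k−1,k−2} ⋯ e^{p,l+1,l}`
if `k − l > 1`, and the product `e^{p,k,k+1} e^{p,k+1,k+2} ⋯ e^{p,l−1,l}` if `k − l < −1`. -/
noncomputable def pathB (K : Type) [Field K] {m n : ℕ} (hm : 0 < m) (hn : 0 < n)
    (p : ℕ) (k l : Fin n) :
    Matrix (Fin (m ^ (p + 1))) (Fin (m ^ (p + 1))) (BAlg K m n hm hn) :=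
  if h : (k : ℕ) ≤ (l : ℕ) + 1 ∧ (l : ℕ) ≤ (k : ℕ) + 1 then eB K hm hn p k l h
  else if hlt : (l : ℕ) < (k : ℕ) then
    (List.ofFn fun s : Fin ((k : ℕ) - (l : ℕ)) =>
      eB K hm hn p ⟨(k : ℕ) - (s : ℕ), by have := s.isLt; have := k.isLt; omega⟩
        ⟨(k : ℕ) - (s : ℕ) - 1, by have := s.isLt; have := k.isLt; omega⟩
        ⟨by have := s.isLt; simp only [Fin.val_mk]; omega,
         by have := s.isLt; simp only [Fin.val_mk]; omega⟩).prod
  else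
    (List.ofFn fun s : Fin ((l : ℕ) - (k : ℕ)) =>
      eB K hm hn p ⟨(k : ℕ) + (s : ℕ), by have := s.isLt; have := l.isLt; omega⟩
        ⟨(k : ℕ) + (s : ℕ) + 1, by have := s.isLt; have := l.isLt; omega⟩
        ⟨by have := s.isLt; simp only [Fin.val_mk]; omega,
         by have := s.isLt; simp only [Fin.val_mk]; omega⟩).prod

/-- Every statement about pairs of indices follows by walking away from the diagonal in unit
steps of the second index. -/
theorem Fin.walk_induction {n : ℕ} {k : Fin n} {motive : Fin n → Prop} (self : motive k)
    (step : ∀ l l' : Fin n, ((k : ℕ) ≤ l ∧ (l' : ℕ) = l + 1 ∨ (l : ℕ) ≤ k ∧ (l : ℕ) = l' + 1) →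
      motive l → motive l') (l : Fin n) : motive l := by
  have up : ∀ d : ℕ, ∀ l : Fin n, (l : ℕ) = k + d → motive l := by
    intro d
    induction d with
    | zero =>
      intro l hl
      obtain rfl : l = k := Fin.ext (by omega)
      exact self
    | succ d ih =>
      intro l hl
      exact step ⟨k + d, by omega⟩ l (Or.inl ⟨by simp, by simp only; omega⟩) (ih _ rfl)
  have down : ∀ d : ℕ, ∀ l : Fin n, (k : ℕ) = l + d → motive l := by
    intro d
    induction d with
    | zero =>
      intro l hl
      obtain rfl : l = k := Fin.ext (by omega)
      exact self
    | succ d ih =>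
      intro l hl
      exact step ⟨l + 1, by omega⟩ l (Or.inr ⟨by simp only; omega, rfl⟩)
        (ih _ (by simp only; omega))
  rcases le_total (k : ℕ) l with h | h
  · exact up (l - k) l (by omega)
  · exact down (k - l) l (by omega)

theorem List.prod_ofFn_castLast {R : Type*} [Monoid R] {a b : ℕ} (h : a = b + 1)
    (f : Fin a → R) :
    (List.ofFn f).prod =
      (List.ofFn fun s : Fin b => f ⟨s, by omega⟩).prod * f ⟨b, by omega⟩ := by
  subst h
  rw [List.ofFn_succ', List.concat_eq_append, List.prod_append, List.prod_singleton]
  rfl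

theorem List.prod_ofFn_of_eq_one {R : Type*} [Monoid R] {a : ℕ} (h : a = 1) (f : Fin a → R) :
    (List.ofFn f).prod = f ⟨0, by omega⟩ := by
  subst h
  simp

section Relations

variable {K : Type} [Field K] {m n : ℕ} (hm : 0 < m) (hn : 0 < n)

theorem eA_mul_eA (p : ℕ) (k l k' l' : Fin n) :
    eA K hm hn p k l * eA K hm hn p k' l' = if l = k' then eA K hm hn p k l' else 0 := by
  rw [eA, eA, ← Matrix.map_mul]
  ext i j
  have h := RingQuot.mkAlgHom_rel K (ARel.mul (K := K) (hm := hm) (hn := hn) p k l k' l' i j)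
  rw [Matrix.map_apply, h]
  split_ifs <;> simp [eA]

theorem eB_mul_eB_of_ne (p : ℕ) {k l k' l' : Fin n}
    (hkl : (k : ℕ) ≤ (l : ℕ) + 1 ∧ (l : ℕ) ≤ (k : ℕ) + 1)
    (hk'l' : (k' : ℕ) ≤ (l' : ℕ) + 1 ∧ (l' : ℕ) ≤ (k' : ℕ) + 1) (hne : l ≠ k') :
    eB K hm hn p k l hkl * eB K hm hn p k' l' hk'l' = 0 := by
  rw [eB, eB, ← Matrix.map_mul]
  ext i j
  have h := RingQuot.mkAlgHom_rel K
    (BRel.mul0 (K := K) (hm := hm) (hn := hn) p k l k' l' hkl hk'l' hne i j)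
  rw [Matrix.map_apply, h]
  simp

theorem eB_mul_eB (p : ℕ) {k l l' : Fin n}
    (hkl : (k : ℕ) ≤ (l : ℕ) + 1 ∧ (l : ℕ) ≤ (k : ℕ) + 1)
    (hll' : (l : ℕ) ≤ (l' : ℕ) + 1 ∧ (l' : ℕ) ≤ (l : ℕ) + 1)
    (hkl' : (k : ℕ) ≤ (l' : ℕ) + 1 ∧ (l' : ℕ) ≤ (k : ℕ) + 1) :
    eB K hm hn p k l hkl * eB K hm hn p l l' hll' = eB K hm hn p k l' hkl' := by
  rw [eB, eB, ← Matrix.map_mul]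
  ext i j
  have h := RingQuot.mkAlgHom_rel K
    (BRel.mul1 (K := K) (hm := hm) (hn := hn) p k l l' hkl hll' hkl' i j)
  rw [Matrix.map_apply, h]
  simp [eB]

theorem eB_congr (p : ℕ) {k l k' l' : Fin n} (hk : (k : ℕ) = k') (hl : (l : ℕ) = l')
    {h : (k : ℕ) ≤ (l : ℕ) + 1 ∧ (l : ℕ) ≤ (k : ℕ) + 1}
    {h' : (k' : ℕ) ≤ (l' : ℕ) + 1 ∧ (l' : ℕ) ≤ (k' : ℕ) + 1} :
    eB K hm hn p k l h = eB K hm hn p k' l' h' := by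
  obtain rfl := Fin.ext hk
  obtain rfl := Fin.ext hl
  rfl

theorem pathB_eq_eB (p : ℕ) {k l : Fin n}
    (h : (k : ℕ) ≤ (l : ℕ) + 1 ∧ (l : ℕ) ≤ (k : ℕ) + 1) :
    pathB K hm hn p k l = eB K hm hn p k l h :=
  dif_pos h

theorem pathB_eq_prod_of_gt (p : ℕ) {k l : Fin n} (hlt : (l : ℕ) < k) :
    pathB K hm hn p k l = (List.ofFn fun s : Fin ((k : ℕ) - (l : ℕ)) =>
      eB K hm hn p ⟨(k : ℕ) - (s : ℕ), by omega⟩ ⟨(k : ℕ) - (s : ℕ) - 1, by omega⟩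
        ⟨by simp only; omega, by simp only; omega⟩).prod := by
  by_cases h : (k : ℕ) ≤ (l : ℕ) + 1 ∧ (l : ℕ) ≤ (k : ℕ) + 1
  · rw [pathB_eq_eB hm hn p h, List.prod_ofFn_of_eq_one (by omega)]
    exact eB_congr hm hn p (by simp) (by simp only; omega)
  · rw [pathB, dif_neg h, dif_pos hlt]

theorem pathB_eq_prod_of_lt (p : ℕ) {k l : Fin n} (hlt : (k : ℕ) < l) :
    pathB K hm hn p k l = (List.ofFn fun s : Fin ((l : ℕ) - (k : ℕ)) =>
      eB K hm hn p ⟨(k : ℕ) + (s : ℕ), by omega⟩ ⟨(k : ℕ) + (s : ℕ) + 1, by omega⟩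
        ⟨by simp only; omega, by simp only; omega⟩).prod := by
  by_cases h : (k : ℕ) ≤ (l : ℕ) + 1 ∧ (l : ℕ) ≤ (k : ℕ) + 1
  · rw [pathB_eq_eB hm hn p h, List.prod_ofFn_of_eq_one (by omega)]
    exact eB_congr hm hn p (by simp) (by simp only; omega)
  · rw [pathB, dif_neg h, dif_neg (by omega)]

/-- A path is extended by a unit step leading away from its starting point. -/
theorem pathB_step (p : ℕ) {k l l' : Fin n}
    (h : (k : ℕ) ≤ l ∧ (l' : ℕ) = l + 1 ∨ (l : ℕ) ≤ k ∧ (l : ℕ) = l' + 1)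
    (hll' : (l : ℕ) ≤ (l' : ℕ) + 1 ∧ (l' : ℕ) ≤ (l : ℕ) + 1) :
    pathB K hm hn p k l' = pathB K hm hn p k l * eB K hm hn p l l' hll' := by
  by_cases hkl : k = l
  · subst hkl
    rw [pathB_eq_eB hm hn p hll', pathB_eq_eB hm hn p ⟨Nat.le_succ _, Nat.le_succ _⟩, eB_mul_eB]
  have hkl : (k : ℕ) ≠ l := fun e => hkl (Fin.ext e)
  rcases h with ⟨h, e⟩ | ⟨h, e⟩
  · rw [pathB_eq_prod_of_lt hm hn p (l := l') (by omega),
      pathB_eq_prod_of_lt hm hn p (l := l) (by omega),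
      List.prod_ofFn_castLast (b := (l : ℕ) - k) (by omega)]
    exact congrArg _ (eB_congr hm hn p (by simp only; omega) (by simp only; omega))
  · rw [pathB_eq_prod_of_gt hm hn p (l := l') (by omega),
      pathB_eq_prod_of_gt hm hn p (l := l) (by omega),
      List.prod_ofFn_castLast (b := (k : ℕ) - l) (by omega)]
    exact congrArg _ (eB_congr hm hn p (by simp only; omega) (by simp only; omega))

theorem pathB_mul_eB_self (p : ℕ) (k l : Fin n) :
    pathB K hm hn p k l * eB K hm hn p l l ⟨Nat.le_succ _, Nat.le_succ _⟩ =
      pathB K hm hn p k l := by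
  induction l using Fin.walk_induction (k := k) with
  | self => rw [pathB_eq_eB hm hn p ⟨Nat.le_succ _, Nat.le_succ _⟩, eB_mul_eB]
  | step l l' h _ =>
    have hll' : (l : ℕ) ≤ (l' : ℕ) + 1 ∧ (l' : ℕ) ≤ (l : ℕ) + 1 := by omega
    rw [pathB_step hm hn p h hll', mul_assoc, eB_mul_eB hm hn p hll' _ hll']

theorem pathB_mul_eB (p : ℕ) (k : Fin n) {l l' : Fin n}
    (hll' : (l : ℕ) ≤ (l' : ℕ) + 1 ∧ (l' : ℕ) ≤ (l : ℕ) + 1) :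
    pathB K hm hn p k l * eB K hm hn p l l' hll' = pathB K hm hn p k l' := by
  by_cases away : (k : ℕ) ≤ l ∧ (l' : ℕ) = l + 1 ∨ (l : ℕ) ≤ k ∧ (l : ℕ) = l' + 1
  · rw [pathB_step hm hn p away hll']
  by_cases hl : l = l'
  · subst hl
    exact pathB_mul_eB_self hm hn p k l
  have hl : (l : ℕ) ≠ l' := fun e => hl (Fin.ext e)
  rw [pathB_step hm hn p (l := l') (l' := l) (by omega) hll'.symm, mul_assoc,
    eB_mul_eB hm hn p hll'.symm hll' ⟨Nat.le_succ _, Nat.le_succ _⟩, pathB_mul_eB_self]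

theorem pathB_mul_pathB (p : ℕ) (k l k' l' : Fin n) :
    pathB K hm hn p k l * pathB K hm hn p k' l' =
      if l = k' then pathB K hm hn p k l' else 0 := by
  induction l' using Fin.walk_induction (k := k') with
  | self =>
    rw [pathB_eq_eB hm hn p (k := k') (l := k') ⟨Nat.le_succ _, Nat.le_succ _⟩]
    split_ifs with h
    · subst h
      exact pathB_mul_eB_self hm hn p k l
    · rw [← pathB_mul_eB_self, mul_assoc, eB_mul_eB_of_ne hm hn p _ _ h, mul_zero]
  | step l₁ l₂ h ih =>
    have h₁₂ : (l₁ : ℕ) ≤ (l₂ : ℕ) + 1 ∧ (l₂ : ℕ) ≤ (l₁ : ℕ) + 1 := by omega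
    rw [pathB_step hm hn p h h₁₂, ← mul_assoc, ih]
    split_ifs
    · exact pathB_mul_eB hm hn p k h₁₂
    · exact zero_mul _

/-- The homomorphism `A(m,n) → B(m,n)` given on generators by `pathB`. -/
noncomputable def toB : AAlg K m n hm hn →ₐ[K] BAlg K m n hm hn :=
  RingQuot.liftAlgHom K ⟨FreeAlgebra.lift K fun g => pathB K hm hn g.1 g.2.1 g.2.2.1 g.2.2.2.1
      g.2.2.2.2, by
    intro x y hxy
    cases hxy with
    | mul p k l k' l' i j =>
      have h := congrFun (congrFun (pathB_mul_pathB (K := K) hm hn p k l k' l') i) j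
      simp only [Matrix.mul_apply, map_sum, map_mul, EmF, Matrix.of_apply,
        FreeAlgebra.lift_ι_apply] at h ⊢
      rw [h]
      split_ifs <;> simp
    | sum0 i j =>
      have h := RingQuot.mkAlgHom_rel K (BRel.sum0 (K := K) (n := n) (hm := hm) (hn := hn) i j)
      simp only [map_sum, EmF, Matrix.of_apply, FreeAlgebra.lift_ι_apply] at h ⊢
      simp only [pathB_eq_eB hm hn _ ⟨Nat.le_succ _, Nat.le_succ _⟩, eB, Matrix.map_apply]
      rw [h]
      split_ifs <;> simp
    | sumS p i j =>
      have h := RingQuot.mkAlgHom_rel K (BRel.sumS (K := K) (n := n) (hm := hm) (hn := hn) p i j)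
      simp only [map_sum, EmF, Matrix.of_apply, FreeAlgebra.lift_ι_apply] at h ⊢
      simp only [pathB_eq_eB hm hn _ ⟨Nat.le_succ _, Nat.le_succ _⟩, eB, Matrix.map_apply]
      rw [h]
      split_ifs
      · simp [pathB_eq_eB hm hn _ ⟨Nat.le_succ _, Nat.le_succ _⟩, eB]
      · simp⟩

theorem toB_mkA (g : AGen m n) :
    toB hm hn (mkA K hm hn g) = pathB K hm hn g.1 g.2.1 g.2.2.1 g.2.2.2.1 g.2.2.2.2 := by
  rw [toB, mkA, RingQuot.liftAlgHom_mkAlgHom_apply, FreeAlgebra.lift_ι_apply]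

/-- The homomorphism `B(m,n) → A(m,n)` sending generators to generators. -/
noncomputable def ofB : BAlg K m n hm hn →ₐ[K] AAlg K m n hm hn :=
  RingQuot.liftAlgHom K ⟨FreeAlgebra.lift K fun g => mkA K hm hn g.1, by
    intro x y hxy
    cases hxy with
    | mul0 p k l k' l' hkl hk'l' hne i j =>
      have h := congrFun (congrFun (eA_mul_eA (K := K) hm hn p k l k' l') i) j
      simpa [Matrix.mul_apply, EmB, eA, EmF, mkA, hne] using h
    | mul1 p k l l' hkl hll' hkl' i j =>
      have h := congrFun (congrFun (eA_mul_eA (K := K) hm hn p k l l l') i) j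
      simpa [Matrix.mul_apply, EmB, eA, EmF, mkA] using h
    | sum0 i j =>
      have h := RingQuot.mkAlgHom_rel K (ARel.sum0 (K := K) (n := n) (hm := hm) (hn := hn) i j)
      simp only [map_sum, EmB, EmF, Matrix.of_apply, FreeAlgebra.lift_ι_apply, mkA] at h ⊢
      rw [h]
      split_ifs <;> simp
    | sumS p i j =>
      have h := RingQuot.mkAlgHom_rel K (ARel.sumS (K := K) (n := n) (hm := hm) (hn := hn) p i j)
      simp only [map_sum, EmB, EmF, Matrix.of_apply, FreeAlgebra.lift_ι_apply, mkA] at h ⊢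
      rw [h]
      split_ifs <;> simp⟩

theorem ofB_mkB (g : BGen m n) : ofB hm hn (mkB K hm hn g) = mkA K hm hn g.1 := by
  rw [ofB, mkB, RingQuot.liftAlgHom_mkAlgHom_apply, FreeAlgebra.lift_ι_apply]

theorem map_ofB_eB (p : ℕ) {k l : Fin n}
    (h : (k : ℕ) ≤ (l : ℕ) + 1 ∧ (l : ℕ) ≤ (k : ℕ) + 1) :
    (eB K hm hn p k l h).map (ofB hm hn) = eA K hm hn p k l := by
  ext i j
  exact ofB_mkB hm hn ⟨⟨p, k, l, i, j⟩, h⟩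

theorem map_ofB_pathB (p : ℕ) (k l : Fin n) :
    (pathB K hm hn p k l).map (ofB hm hn) = eA K hm hn p k l := by
  induction l using Fin.walk_induction (k := k) with
  | self => rw [pathB_eq_eB hm hn p ⟨Nat.le_succ _, Nat.le_succ _⟩, map_ofB_eB]
  | step l l' h ih =>
    rw [pathB_step hm hn p h (by omega), Matrix.map_mul, ih, map_ofB_eB, eA_mul_eA, if_pos rfl]

theorem toB_comp_ofB : (toB hm hn).comp (ofB hm hn) = AlgHom.id K (BAlg K m n hm hn) := by
  apply RingQuot.ringQuot_ext'
  apply FreeAlgebra.hom_ext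
  funext g
  obtain ⟨⟨p, k, l, i, j⟩, h⟩ := g
  change toB hm hn (ofB hm hn (mkB K hm hn ⟨⟨p, k, l, i, j⟩, h⟩)) = mkB K hm hn _
  rw [ofB_mkB, toB_mkA, pathB_eq_eB hm hn p h]
  rfl

theorem ofB_comp_toB : (ofB hm hn).comp (toB hm hn) = AlgHom.id K (AAlg K m n hm hn) := by
  apply RingQuot.ringQuot_ext'
  apply FreeAlgebra.hom_ext
  funext g
  obtain ⟨p, k, l, i, j⟩ := g
  change ofB hm hn (toB hm hn (mkA K hm hn ⟨p, k, l, i, j⟩)) = mkA K hm hn _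
  rw [toB_mkA]
  exact congrFun (congrFun (map_ofB_pathB hm hn p k l) i) j

end Relations

/-- (Theorem `thmAmn=Bmn`.) The map sending (entrywise) `e^{p,k,l}` of
`A(m,n)` to `e^{p,k,l}` if `|k−l| ≤ 1`, to `e^{p,k,k−1} e^{p,k−1,k−2} ⋯ e^{p,l+1,l}` if
`k−l > 1`, and to `e^{p,k,k+1} e^{p,k+1,k+2} ⋯ e^{p,l−1,l}` if `k−l < −1`, is a well-defined
`K`-algebra isomorphism `A(m,n) → B(m,n)` whose inverse sends each generator `e^{p,k,l}_{ij}`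
of `B(m,n)` to the corresponding generator of `A(m,n)`. -/
theorem stmt18 (K : Type) [Field K] (m n : ℕ) (hm : 0 < m) (hn : 0 < n) :
    ∃ φ : AAlg K m n hm hn ≃ₐ[K] BAlg K m n hm hn,
      (∀ (p : ℕ) (k l : Fin n) (i j : Fin (m ^ (p + 1))),
        φ (mkA K hm hn (⟨p, k, l, i, j⟩ : AGen m n)) = pathB K hm hn p k l i j) ∧
      (∀ g : BGen m n, φ.symm (mkB K hm hn g) = mkA K hm hn g.1) := by
  exact ⟨AlgEquiv.ofAlgHom (toB hm hn) (ofB hm hn) (toB_comp_ofB hm hn) (ofB_comp_toB hm hn),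
    fun p k l i j => toB_mkA hm hn ⟨p, k, l, i, j⟩, ofB_mkB hm hn⟩
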